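/- arXiv:2308.05299 — 3 statements merged into one kernel-verified Lean document; each statement's English description precedes it below -/
import Mathlib

section
/- Let R be a G-graded domain and S a graded overring of R. Then S satisfies graded going-down (gGD) over R if and only if for each homogeneous prime Q of S, the map h-Spec(S_(Q)) → h-Spec(R_(Q∩R)) induced by contraction of homogeneous prime ideals is surjective. -/
/-! Core definitions for graded perinormality, following Epstein–Shapiro style graded notions. -/

section Core

variable {ι : Type*} [DecidableEq ι] [AddCommMonoid ι]
variable {R : Type*} [CommRing R]

/-- `𝒜` is a grading of the ring `R` by the (torsionless) monoid `ι`: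
the components multiply correctly and give an internal direct sum decomposition. -/
structure IsGrRing (𝒜 : ι → AddSubgroup R) : Prop where
  one_mem : (1 : R) ∈ 𝒜 0
  mul_mem : ∀ {i j : ι} {a b : R}, a ∈ 𝒜 i → b ∈ 𝒜 j → a * b ∈ 𝒜 (i + j)
  internal : DirectSum.IsInternal 𝒜

/-- An ideal of `R` is homogeneous iff every element of it is a finite sum of
homogeneous elements of the ideal. -/
def IsHomIdeal (𝒜 : ι → AddSubgroup R) (I : Ideal R) : Prop :=
  ∀ x ∈ I, x ∈ AddSubmonoid.closure {y : R | SetLike.IsHomogeneousElem 𝒜 y ∧ y ∈ I}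

/-- A graded (homogeneous) maximal ideal: maximal among proper homogeneous ideals. -/
def IsGrMaxIdeal (𝒜 : ι → AddSubgroup R) (I : Ideal R) : Prop :=
  IsHomIdeal 𝒜 I ∧ I ≠ ⊤ ∧ ∀ J : Ideal R, IsHomIdeal 𝒜 J → I ≤ J → J ≠ ⊤ → J = I

/-- `R` is gr-local: it has exactly one graded maximal ideal. -/
def GrLocal (𝒜 : ι → AddSubgroup R) : Prop :=
  ∃! I : Ideal R, IsGrMaxIdeal 𝒜 I

/-- A prime ideal of height one (in a domain). -/
def HeightOnePrime (P : Ideal R) : Prop :=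
  P.IsPrime ∧ P ≠ ⊥ ∧ ∀ Q : Ideal R, Q.IsPrime → Q < P → Q = ⊥

variable [IsDomain R]

/-- A homogeneous element of the graded quotient field of `R`, i.e. a quotient of two
homogeneous elements of `R` (viewed inside the full quotient field). -/
def IsHomFrac (𝒜 : ι → AddSubgroup R) (x : FractionRing R) : Prop :=
  ∃ (i j : ι) (a b : R), a ∈ 𝒜 i ∧ b ∈ 𝒜 j ∧ b ≠ 0 ∧
    x * algebraMap R (FractionRing R) b = algebraMap R (FractionRing R) a

/-- `S` is a graded overring of `R`: a ring between `R` and the graded quotient field that is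
the sum of its homogeneous components, i.e. each of its elements is a finite sum of
homogeneous elements of `S`. -/
def IsGradedOverring (𝒜 : ι → AddSubgroup R) (S : Subalgebra R (FractionRing R)) : Prop :=
  ∀ x ∈ S, x ∈ AddSubmonoid.closure {y : FractionRing R | y ∈ S ∧ IsHomFrac 𝒜 y}

/-- A homogeneous ideal of an overring `S` of `R`. -/
def IsHomIdealOver (𝒜 : ι → AddSubgroup R) (S : Subalgebra R (FractionRing R))
    (I : Ideal S) : Prop :=
  ∀ x ∈ I, (x : FractionRing R) ∈ AddSubmonoid.closure
    {y : FractionRing R | IsHomFrac 𝒜 y ∧ ∃ h : y ∈ S, (⟨y, h⟩ : S) ∈ I}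

/-- A graded maximal ideal of an overring. -/
def IsGrMaxIdealOver (𝒜 : ι → AddSubgroup R) (S : Subalgebra R (FractionRing R))
    (I : Ideal S) : Prop :=
  IsHomIdealOver 𝒜 S I ∧ I ≠ ⊤ ∧
    ∀ J : Ideal S, IsHomIdealOver 𝒜 S J → I ≤ J → J ≠ ⊤ → J = I

/-- The overring `S` is gr-local. -/
def GrLocalOver (𝒜 : ι → AddSubgroup R) (S : Subalgebra R (FractionRing R)) : Prop :=
  ∃! I : Ideal S, IsGrMaxIdealOver 𝒜 S I

/-- `S` satisfies graded going-down (gGD) over `R`. -/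
def GGD (𝒜 : ι → AddSubgroup R) (S : Subalgebra R (FractionRing R)) : Prop :=
  ∀ (P Q : Ideal R) (Qt : Ideal S), P.IsPrime → Q.IsPrime → Qt.IsPrime →
    IsHomIdeal 𝒜 P → IsHomIdeal 𝒜 Q → IsHomIdealOver 𝒜 S Qt → P ≤ Q →
    Qt.comap (algebraMap R S) = Q →
    ∃ Pt : Ideal S, Pt.IsPrime ∧ IsHomIdealOver 𝒜 S Pt ∧ Pt ≤ Qt ∧
      Pt.comap (algebraMap R S) = P

/-- The overring `S` is a localization of `R` (at some multiplicative subset `W` of `R`). -/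
def IsLocalizationOfR (S : Subalgebra R (FractionRing R)) : Prop :=
  ∃ W : Submonoid R, (∀ w ∈ W, IsUnit (algebraMap R S w)) ∧
    ∀ s : S, ∃ (r w : R), w ∈ W ∧ s * algebraMap R S w = algebraMap R S r

/-- `R` is a graded perinormal domain: every gr-local graded overring satisfying gGD is a
localization of `R`. -/
def GradedPerinormal (𝒜 : ι → AddSubgroup R) : Prop :=
  ∀ S : Subalgebra R (FractionRing R),
    IsGradedOverring 𝒜 S → GrLocalOver 𝒜 S → GGD 𝒜 S → IsLocalizationOfR S

/-- `R` is a graded globally perinormal domain: every graded overring satisfying gGD is a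
localization of `R`. -/
def GradedGloballyPerinormal (𝒜 : ι → AddSubgroup R) : Prop :=
  ∀ S : Subalgebra R (FractionRing R),
    IsGradedOverring 𝒜 S → GGD 𝒜 S → IsLocalizationOfR S

/-- The homogeneous localization `R_(P)` of `R` at an ideal `P`: the subring of the graded
quotient field consisting of fractions with homogeneous denominator outside `P`. -/
def HomLocR (𝒜 : ι → AddSubgroup R) (P : Ideal R) : Subalgebra R (FractionRing R) :=
  Algebra.adjoin R {x : FractionRing R | ∃ a w : R, SetLike.IsHomogeneousElem 𝒜 w ∧ w ∉ P ∧
    x * algebraMap R (FractionRing R) w = algebraMap R (FractionRing R) a}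

/-- The homogeneous localization `S_(Q)` of an overring `S` at an ideal `Q` of `S`. -/
def HomLocOver (𝒜 : ι → AddSubgroup R) (S : Subalgebra R (FractionRing R)) (Q : Ideal S) :
    Subalgebra R (FractionRing R) :=
  Algebra.adjoin R {x : FractionRing R | ∃ s w : S, IsHomFrac 𝒜 (w : FractionRing R) ∧
    w ∉ Q ∧ x * (w : FractionRing R) = (s : FractionRing R)}

/-- The localization `R_W` of `R` at a multiplicative set `W`, as a subring of the quotient
field. -/
def LocW (W : Submonoid R) : Subalgebra R (FractionRing R) :=
  Algebra.adjoin R {x : FractionRing R | ∃ r : R, ∃ w ∈ W,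
    x * algebraMap R (FractionRing R) w = algebraMap R (FractionRing R) r}

/-- A subring `V` of the graded quotient field (containing `R`) is a gr-valuation domain:
for every nonzero homogeneous `x` of the graded quotient field, `x ∈ V` or `x⁻¹ ∈ V`. -/
def GrValuation (𝒜 : ι → AddSubgroup R) (V : Subalgebra R (FractionRing R)) : Prop :=
  ∀ x : FractionRing R, x ≠ 0 → IsHomFrac 𝒜 x → x ∈ V ∨ x⁻¹ ∈ V

/-- `R` is a gr-(R₁) domain: the homogeneous localization at every height-one homogeneous
prime is a gr-valuation domain. -/
def GrR1 (𝒜 : ι → AddSubgroup R) : Prop :=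
  ∀ P : Ideal R, HeightOnePrime P → IsHomIdeal 𝒜 P → GrValuation 𝒜 (HomLocR 𝒜 P)

/-- The ideal `I` of `T` is the contraction of the ideal `J` of `S` (that is, `I = J ∩ T`
inside the common quotient field). -/
def Contracts (T S : Subalgebra R (FractionRing R)) (J : Ideal S) (I : Ideal T) : Prop :=
  ∀ x : FractionRing R,
    (∃ h : x ∈ T, (⟨x, h⟩ : T) ∈ I) ↔ (x ∈ T ∧ ∃ h : x ∈ S, (⟨x, h⟩ : S) ∈ J)

/-- `S` satisfies graded going-down over the intermediate ring `T`. -/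
def GGDSub (𝒜 : ι → AddSubgroup R) (T S : Subalgebra R (FractionRing R)) : Prop :=
  ∀ (P Q : Ideal T) (Qt : Ideal S), P.IsPrime → Q.IsPrime → Qt.IsPrime →
    IsHomIdealOver 𝒜 T P → IsHomIdealOver 𝒜 T Q → IsHomIdealOver 𝒜 S Qt → P ≤ Q →
    Contracts T S Qt Q →
    ∃ Pt : Ideal S, Pt.IsPrime ∧ IsHomIdealOver 𝒜 S Pt ∧ Pt ≤ Qt ∧ Contracts T S Pt P

/-- `S` is a localization of the intermediate ring `T` at a multiplicative subset of `T`. -/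
def IsLocalizationOfSub (T S : Subalgebra R (FractionRing R)) : Prop :=
  ∃ W : Submonoid (FractionRing R), (W : Set (FractionRing R)) ⊆ T ∧
    (∀ w ∈ W, ∃ y ∈ S, w * y = 1) ∧ ∀ s ∈ S, ∃ t ∈ T, ∃ w ∈ W, s * w = t

/-- The intermediate ring `T` (e.g. a homogeneous localization of `R`) is a graded
perinormal domain. -/
def GradedPerinormalSub (𝒜 : ι → AddSubgroup R) (T : Subalgebra R (FractionRing R)) : Prop :=
  ∀ S : Subalgebra R (FractionRing R), T ≤ S → IsGradedOverring 𝒜 S → GrLocalOver 𝒜 S →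
    GGDSub 𝒜 T S → IsLocalizationOfSub T S

/-- The intermediate ring `T` is a graded globally perinormal domain. -/
def GradedGloballyPerinormalSub (𝒜 : ι → AddSubgroup R)
    (T : Subalgebra R (FractionRing R)) : Prop :=
  ∀ S : Subalgebra R (FractionRing R), T ≤ S → IsGradedOverring 𝒜 S →
    GGDSub 𝒜 T S → IsLocalizationOfSub T S

/-- `R` is a gr-essential domain: `R` is the intersection of homogeneous localizations at a
family of homogeneous primes, each of which is a gr-valuation domain. -/
def GrEssential (𝒜 : ι → AddSubgroup R) : Prop :=
  ∃ I : Set (Ideal R),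
    (∀ P ∈ I, P.IsPrime ∧ IsHomIdeal 𝒜 P ∧ GrValuation 𝒜 (HomLocR 𝒜 P)) ∧
    ((⊥ : Subalgebra R (FractionRing R)) : Set (FractionRing R)) =
      ⋂ P ∈ I, (HomLocR 𝒜 P : Set (FractionRing R))

/-- The intermediate ring `T` is a gr-essential domain. -/
def GrEssentialSub (𝒜 : ι → AddSubgroup R) (T : Subalgebra R (FractionRing R)) : Prop :=
  ∃ I : Set (Ideal T),
    (∀ P ∈ I, P.IsPrime ∧ IsHomIdealOver 𝒜 T P ∧ GrValuation 𝒜 (HomLocOver 𝒜 T P)) ∧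
    (T : Set (FractionRing R)) = ⋂ P ∈ I, (HomLocOver 𝒜 T P : Set (FractionRing R))

end Core

section HomogeneousFractions

open DirectSum

local notation "Frac" => FractionRing

variable {G R : Type*} [CommRing R]

theorem algebraMap_fractionRing_ne_zero {b : R} (hb : b ≠ 0) : algebraMap R (Frac R) b ≠ 0 :=
  (map_ne_zero_iff _ (IsFractionRing.injective R (Frac R))).2 hb

section

variable (𝒜 : G → AddSubgroup R)

/-- An ideal `J` of a ring `A` mapping to the quotient field of `R` is generated additively by
elements whose images are homogeneous fractions. -/
def IsHomIdealIn {A : Type*} [CommRing A] [Algebra A (Frac R)] (J : Ideal A) : Prop :=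
  ∀ a ∈ J, algebraMap A (Frac R) a ∈
    AddSubmonoid.closure {y : Frac R | IsHomFrac 𝒜 y ∧ ∃ b ∈ J, algebraMap A (Frac R) b = y}

theorem isHomIdealIn_iff_isHomIdealOver {S : Subalgebra R (Frac R)} {J : Ideal S} :
    IsHomIdealIn 𝒜 J ↔ IsHomIdealOver 𝒜 S J := by
  have hset : {y : Frac R | IsHomFrac 𝒜 y ∧ ∃ b ∈ J, algebraMap S (Frac R) b = y} =
      {y : Frac R | IsHomFrac 𝒜 y ∧ ∃ h : y ∈ S, (⟨y, h⟩ : S) ∈ J} := by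
    ext y
    refine and_congr_right fun _ => ⟨?_, fun ⟨h, hy⟩ => ⟨_, hy, rfl⟩⟩
    rintro ⟨b, hb, rfl⟩
    exact ⟨b.2, hb⟩
  rw [IsHomIdealIn, hset]
  rfl

theorem IsGradedOverring.isHomIdealIn_top {S : Subalgebra R (Frac R)}
    (hS : IsGradedOverring 𝒜 S) :
    IsHomIdealIn 𝒜 (⊤ : Ideal S) := by
  intro a _
  refine AddSubmonoid.closure_mono ?_ (hS a a.2)
  exact fun y hy => ⟨hy.2, ⟨y, hy.1⟩, trivial, rfl⟩

end

section

variable {A : Type*} [CommRing A] [Algebra A (Frac R)]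

/-- `L` is the ring of fractions of `A` with denominators in `W`. -/
def IsFractionsOf (W : Submonoid A) (L : Subalgebra R (Frac R)) : Prop :=
  ∀ x : Frac R, x ∈ L ↔ ∃ s w : A, w ∈ W ∧ x * algebraMap A (Frac R) w = algebraMap A (Frac R) s

theorem isFractionsOf_adjoin [Algebra R A] [IsScalarTower R A (Frac R)] (W : Submonoid A) :
    IsFractionsOf W (Algebra.adjoin R
      {x : Frac R | ∃ s w : A, w ∈ W ∧ x * algebraMap A (Frac R) w = algebraMap A (Frac R) s}) := by
  refine fun x => ⟨fun hx => ?_, fun hx => Algebra.subset_adjoin hx⟩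
  induction hx using Algebra.adjoin_induction with
  | mem x hx => exact hx
  | algebraMap r =>
    exact ⟨algebraMap R A r, 1, W.one_mem, by simp [← IsScalarTower.algebraMap_apply]⟩
  | add x y _ _ hx hy =>
    obtain ⟨s, w, hw, h⟩ := hx
    obtain ⟨s', w', hw', h'⟩ := hy
    refine ⟨s * w' + s' * w, w * w', W.mul_mem hw hw', ?_⟩
    simp only [map_mul, map_add, ← h, ← h']
    ring
  | mul x y _ _ hx hy =>
    obtain ⟨s, w, hw, h⟩ := hx
    obtain ⟨s', w', hw', h'⟩ := hy
    refine ⟨s * s', w * w', W.mul_mem hw hw', ?_⟩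
    simp only [map_mul, ← h, ← h']
    ring

theorem IsFractionsOf.algebraMap_mem {W : Submonoid A} {L : Subalgebra R (Frac R)}
    (hL : IsFractionsOf W L) (a : A) : algebraMap A (Frac R) a ∈ L :=
  (hL _).2 ⟨a, 1, W.one_mem, by simp⟩

end

theorem IsHomFrac.inv [IsDomain R] {𝒜 : G → AddSubgroup R} {x : Frac R}
    (hx : IsHomFrac 𝒜 x) : IsHomFrac 𝒜 x⁻¹ := by
  obtain ⟨i, j, a, b, ha, hb, hb0, h⟩ := hx
  rcases eq_or_ne a 0 with rfl | ha0
  · have hx0 : x = 0 := by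
      simpa [algebraMap_fractionRing_ne_zero hb0] using h
    exact ⟨i, j, 0, b, ha, hb, hb0, by simp [hx0]⟩
  · refine ⟨j, i, b, a, hb, ha, ha0, ?_⟩
    have hx0 : x ≠ 0 := by
      rintro rfl
      exact algebraMap_fractionRing_ne_zero ha0 (by rw [← h, zero_mul])
    rw [← h, inv_mul_cancel_left₀ hx0]

variable [DecidableEq G] [AddCommGroup G]

/-- The graded ring structure carried by a family satisfying `IsGrRing`. -/
@[reducible]
noncomputable def IsGrRing.gradedRing {𝒜 : G → AddSubgroup R} (h : IsGrRing 𝒜) :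
    GradedRing 𝒜 :=
  { h.internal.chooseDecomposition with
    one_mem := h.one_mem
    mul_mem := fun _ _ _ _ ha hb => h.mul_mem ha hb }

variable [IsDomain R] {𝒜 : G → AddSubgroup R} [GradedRing 𝒜]

theorem IsHomFrac.mul {x y : Frac R} (hx : IsHomFrac 𝒜 x) (hy : IsHomFrac 𝒜 y) :
    IsHomFrac 𝒜 (x * y) := by
  obtain ⟨i, j, a, b, ha, hb, hb0, h⟩ := hx
  obtain ⟨i', j', a', b', ha', hb', hb0', h'⟩ := hy
  refine ⟨i + i', j + j', a * a', b * b', SetLike.mul_mem_graded ha ha',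
    SetLike.mul_mem_graded hb hb', mul_ne_zero hb0 hb0', ?_⟩
  rw [map_mul, map_mul, ← h, ← h']
  ring

theorem isHomFrac_one : IsHomFrac 𝒜 (1 : Frac R) :=
  ⟨0, 0, 1, 1, SetLike.one_mem_graded 𝒜, SetLike.one_mem_graded 𝒜, one_ne_zero, by simp⟩

theorem isHomFrac_algebraMap_iff {r : R} :
    IsHomFrac 𝒜 (algebraMap R (Frac R) r) ↔ SetLike.IsHomogeneousElem 𝒜 r := by
  constructor
  · rintro ⟨i, j, a, b, ha, hb, hb0, h⟩
    rw [← map_mul] at h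
    have hab : r * b = a := IsFractionRing.injective R (Frac R) h
    refine ⟨i - j, ?_⟩
    have hr : (decompose 𝒜 r (i - j) : R) = r := by
      apply mul_right_cancel₀ hb0
      rw [← coe_decompose_mul_add_of_right_mem 𝒜 hb, hab, sub_add_cancel,
        decompose_of_mem_same 𝒜 ha]
    rw [← hr]
    exact SetLike.coe_mem _
  · rintro ⟨i, hi⟩
    exact ⟨i, 0, r, 1, hi, SetLike.one_mem_graded 𝒜, one_ne_zero, by simp⟩

variable (𝒜) in
/-- A sum of homogeneous fractions taken from `N` is a fraction `c / b` with homogeneous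
denominator `b`, all of whose homogeneous components lie in `N`. -/
theorem exists_components_of_mem_closure (N : AddSubmonoid (Frac R)) {x : Frac R}
    (hx : x ∈ AddSubmonoid.closure {y : Frac R | IsHomFrac 𝒜 y ∧ y ∈ N}) :
    ∃ (j : G) (b c : R), b ∈ 𝒜 j ∧ b ≠ 0 ∧
      x * algebraMap R (Frac R) b = algebraMap R (Frac R) c ∧
      ∀ d, ∃ z ∈ N,
        z * algebraMap R (Frac R) b = algebraMap R (Frac R) (decompose 𝒜 c (d + j)) := by
  induction hx using AddSubmonoid.closure_induction with
  | mem x hx =>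
    obtain ⟨⟨i, j, a, b, ha, hb, hb0, h⟩, hN⟩ := hx
    refine ⟨j, b, a, hb, hb0, h, fun d => ?_⟩
    rcases eq_or_ne i (d + j) with rfl | hne
    · exact ⟨x, hN, by rw [decompose_of_mem_same 𝒜 ha, h]⟩
    · exact ⟨0, N.zero_mem, by rw [decompose_of_mem_ne 𝒜 ha hne]; simp⟩
  | zero =>
    exact ⟨0, 1, 0, SetLike.one_mem_graded 𝒜, one_ne_zero, by simp,
      fun d => ⟨0, N.zero_mem, by simp⟩⟩
  | add x y _ _ ihx ihy =>
    obtain ⟨j, b, c, hb, hb0, h, hz⟩ := ihx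
    obtain ⟨j', b', c', hb', hb0', h', hz'⟩ := ihy
    refine ⟨j + j', b * b', c * b' + c' * b, SetLike.mul_mem_graded hb hb',
      mul_ne_zero hb0 hb0', ?_, fun d => ?_⟩
    · simp only [map_mul, map_add, ← h, ← h']
      ring
    · obtain ⟨z, hzN, hz⟩ := hz d
      obtain ⟨z', hzN', hz'⟩ := hz' d
      refine ⟨z + z', N.add_mem hzN hzN', ?_⟩
      have h1 : (decompose 𝒜 (c * b') (d + (j + j')) : R) = decompose 𝒜 c (d + j) * b' := by
        rw [← add_assoc, coe_decompose_mul_add_of_right_mem 𝒜 hb']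
      have h2 : (decompose 𝒜 (c' * b) (d + (j + j')) : R) = decompose 𝒜 c' (d + j') * b := by
        rw [add_comm j, ← add_assoc, coe_decompose_mul_add_of_right_mem 𝒜 hb]
      rw [decompose_add, DirectSum.add_apply, AddSubgroup.coe_add, h1, h2, map_add, map_mul,
        map_mul, map_mul, ← hz, ← hz']
      ring

/-- Homogeneous components are unique, so the sums of homogeneous fractions from `N` that are
also sums of homogeneous fractions from `M` are sums of homogeneous fractions from `N ⊓ M`. -/
theorem mem_closure_isHomFrac_inf (N M : AddSubmonoid (Frac R)) {x : Frac R}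
    (hN : x ∈ AddSubmonoid.closure {y : Frac R | IsHomFrac 𝒜 y ∧ y ∈ N})
    (hM : x ∈ AddSubmonoid.closure {y : Frac R | IsHomFrac 𝒜 y ∧ y ∈ M}) :
    x ∈ AddSubmonoid.closure {y : Frac R | IsHomFrac 𝒜 y ∧ y ∈ N ⊓ M} := by
  classical
  obtain ⟨j, b, c, hb, hb0, h, hz⟩ := exists_components_of_mem_closure 𝒜 N hN
  obtain ⟨j', b', c', hb', hb0', h', hz'⟩ := exists_components_of_mem_closure 𝒜 M hM
  have hB := algebraMap_fractionRing_ne_zero hb0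
  have hB' := algebraMap_fractionRing_ne_zero hb0'
  have hcc : c * b' = c' * b := by
    apply IsFractionRing.injective R (Frac R)
    rw [map_mul, map_mul, ← h, ← h']
    ring
  have hx : x = ∑ e ∈ (decompose 𝒜 c).support,
      algebraMap R (Frac R) (decompose 𝒜 c e) / algebraMap R (Frac R) b := by
    rw [← Finset.sum_div, ← map_sum, sum_support_decompose, ← h, mul_div_cancel_right₀ _ hB]
  rw [hx]
  refine sum_mem fun e _ => AddSubmonoid.subset_closure ⟨?_, ?_, ?_⟩
  · exact ⟨e, j, _, b, SetLike.coe_mem _, hb, hb0, div_mul_cancel₀ _ hB⟩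
  · obtain ⟨z, hzN, hz⟩ := hz (e - j)
    rw [sub_add_cancel] at hz
    rwa [← hz, mul_div_cancel_right₀ _ hB]
  · obtain ⟨z, hzM, hz⟩ := hz' (e - j)
    have hcomp : (decompose 𝒜 c e : R) * b' = decompose 𝒜 c' (e - j + j') * b := by
      rw [← coe_decompose_mul_add_of_right_mem 𝒜 hb', ← coe_decompose_mul_add_of_right_mem 𝒜 hb,
        hcc, show e - j + j' + j = e + j' by abel]
    have hzc : algebraMap R (Frac R) (decompose 𝒜 c e) = z * algebraMap R (Frac R) b := by
      apply mul_right_cancel₀ hB'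
      rw [← map_mul, hcomp, map_mul, ← hz]
      ring
    rwa [hzc, mul_div_cancel_right₀ _ hB]

variable (𝒜)

theorem isHomIdealIn_iff_isHomIdeal {P : Ideal R} : IsHomIdealIn 𝒜 P ↔ IsHomIdeal 𝒜 P := by
  have hset : {y : Frac R | IsHomFrac 𝒜 y ∧ ∃ b ∈ P, algebraMap R (Frac R) b = y} =
      (algebraMap R (Frac R) : R →+ Frac R) ''
        {y : R | SetLike.IsHomogeneousElem 𝒜 y ∧ y ∈ P} := by
    ext y
    constructor
    · rintro ⟨hy, b, hb, rfl⟩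
      exact ⟨b, ⟨isHomFrac_algebraMap_iff.1 hy, hb⟩, rfl⟩
    · rintro ⟨b, ⟨hb, hbP⟩, rfl⟩
      exact ⟨isHomFrac_algebraMap_iff.2 hb, b, hbP, rfl⟩
  rw [IsHomIdealIn, hset, ← AddMonoidHom.map_mclosure]
  refine forall₂_congr fun a _ => ?_
  exact AddSubmonoid.mem_map_iff_mem (f := (algebraMap R (Frac R) : R →+ Frac R))
    (IsFractionRing.injective R (Frac R))

theorem isHomIdealIn_top : IsHomIdealIn 𝒜 (⊤ : Ideal R) := by
  classical
  rw [isHomIdealIn_iff_isHomIdeal]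
  intro x _
  rw [← sum_support_decompose 𝒜 x]
  exact sum_mem fun i _ => AddSubmonoid.subset_closure ⟨⟨i, SetLike.coe_mem _⟩, trivial⟩

theorem IsHomIdealIn.comap {A B : Type*} [CommRing A] [CommRing B]
    [Algebra A (Frac R)] [Algebra B (Frac R)]
    (hAh : IsHomIdealIn 𝒜 (⊤ : Ideal A)) (hB : Function.Injective (algebraMap B (Frac R)))
    (f : A →+* B) (hf : ∀ a, algebraMap B (Frac R) (f a) = algebraMap A (Frac R) a)
    {J : Ideal B} (hJ : IsHomIdealIn 𝒜 J) : IsHomIdealIn 𝒜 (J.comap f) := by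
  intro a ha
  have h1 := hJ (f a) ha
  rw [hf] at h1
  have h2 : algebraMap A (Frac R) a ∈ AddSubmonoid.closure {y | IsHomFrac 𝒜 y ∧
      y ∈ AddMonoidHom.mrange (algebraMap A (Frac R) : A →+ Frac R)} := by
    refine AddSubmonoid.closure_mono ?_ (hAh a trivial)
    exact fun y hy => ⟨hy.1, hy.2.imp fun b hb => hb.2⟩
  have h3 := mem_closure_isHomFrac_inf
    (J.toAddSubmonoid.map (algebraMap B (Frac R) : B →+ Frac R))
    _ h1 h2
  refine AddSubmonoid.closure_mono ?_ h3
  rintro _ ⟨hy, ⟨q, hq, hqb⟩, b, rfl⟩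
  have hfb : f b = q := hB ((hf b).trans hqb.symm)
  exact ⟨hy, b, by rwa [Ideal.mem_comap, hfb], rfl⟩

section Localization

variable {A : Type*} [CommRing A] [Algebra A (Frac R)]

/-- The elements outside a prime ideal whose images are homogeneous fractions. -/
def homDenominators (Q : Ideal A) [hQ : Q.IsPrime] : Submonoid A where
  carrier := {w | IsHomFrac 𝒜 (algebraMap A (Frac R) w) ∧ w ∉ Q}
  one_mem' := ⟨by rw [map_one]; exact isHomFrac_one, Q.one_notMem⟩
  mul_mem' := fun ha hb => ⟨by rw [map_mul]; exact ha.1.mul hb.1,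
    fun h => (hQ.mem_or_mem h).elim ha.2 hb.2⟩

variable {𝒜}

theorem algebraMap_ne_zero_of_mem_homDenominators (hA : Function.Injective (algebraMap A (Frac R)))
    {Q : Ideal A} [Q.IsPrime] {w : A} (hw : w ∈ homDenominators 𝒜 Q) :
    algebraMap A (Frac R) w ≠ 0 :=
  (map_ne_zero_iff _ hA).2 fun h => hw.2 (h ▸ Q.zero_mem)

theorem isFractionsOf_homLocOver (S : Subalgebra R (Frac R)) (Q : Ideal S) [Q.IsPrime] :
    IsFractionsOf (homDenominators 𝒜 Q) (HomLocOver 𝒜 S Q) := by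
  have h := isFractionsOf_adjoin (R := R) (homDenominators 𝒜 Q)
  convert h using 1
  rw [HomLocOver]
  congr 1
  ext x
  exact exists₂_congr fun s w => and_assoc.symm

theorem isFractionsOf_homLocR (P : Ideal R) [P.IsPrime] :
    IsFractionsOf (homDenominators 𝒜 P) (HomLocR 𝒜 P) := by
  have h := isFractionsOf_adjoin (R := R) (homDenominators 𝒜 P)
  convert h using 1
  rw [HomLocR]
  congr 1
  ext x
  refine exists₂_congr fun s w => ?_
  rw [← isHomFrac_algebraMap_iff, ← and_assoc]
  rfl

/-- A homogeneous prime `J` contained in `Q` extends to a homogeneous prime of the localization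
at the homogeneous elements outside `Q`. -/
theorem IsFractionsOf.exists_extension (hA : Function.Injective (algebraMap A (Frac R)))
    {Q : Ideal A} [Q.IsPrime] {L : Subalgebra R (Frac R)}
    (hL : IsFractionsOf (homDenominators 𝒜 Q) L)
    {J : Ideal A} (hJ : J.IsPrime) (hJh : IsHomIdealIn 𝒜 J) (hJQ : J ≤ Q) :
    ∃ 𝔮 : Ideal L, 𝔮.IsPrime ∧ IsHomIdealOver 𝒜 L 𝔮 ∧
      ∀ (x : L) (a w : A), w ∈ homDenominators 𝒜 Q →
        (x : Frac R) * algebraMap A (Frac R) w = algebraMap A (Frac R) a → (x ∈ 𝔮 ↔ a ∈ J) := by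
  let W := homDenominators 𝒜 Q
  have hWJ : ∀ {w}, w ∈ W → w ∉ J := fun hw h => hw.2 (hJQ h)
  let 𝔮 : Ideal L :=
    { carrier := {x | ∃ s w : A, s ∈ J ∧ w ∈ W ∧
        (x : Frac R) * algebraMap A (Frac R) w = algebraMap A (Frac R) s}
      zero_mem' := ⟨0, 1, J.zero_mem, W.one_mem, by simp⟩
      add_mem' := by
        rintro x y ⟨s, w, hs, hw, h⟩ ⟨s', w', hs', hw', h'⟩
        refine ⟨s * w' + s' * w, w * w', J.add_mem (J.mul_mem_right _ hs) (J.mul_mem_right _ hs'),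
          W.mul_mem hw hw', ?_⟩
        simp only [map_mul, map_add, ← h, ← h', Subalgebra.coe_add]
        ring
      smul_mem' := by
        rintro c x ⟨s, w, hs, hw, h⟩
        obtain ⟨t, v, hv, h'⟩ := (hL c).1 c.2
        refine ⟨t * s, v * w, J.mul_mem_left _ hs, W.mul_mem hv hw, ?_⟩
        simp only [map_mul, ← h, ← h', smul_eq_mul, Subalgebra.coe_mul]
        ring }
  have hmem : ∀ (x : L) (a w : A), w ∈ W →
      (x : Frac R) * algebraMap A (Frac R) w = algebraMap A (Frac R) a → (x ∈ 𝔮 ↔ a ∈ J) := by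
    refine fun x a w hw h => ⟨?_, fun ha => ⟨a, w, ha, hw, h⟩⟩
    rintro ⟨s, w', hs, hw', h'⟩
    have hcross : a * w' = s * w := by
      apply hA
      rw [map_mul, map_mul, ← h, ← h']
      ring
    exact (hJ.mem_or_mem (hcross ▸ J.mul_mem_right w hs : a * w' ∈ J)).resolve_right (hWJ hw')
  refine ⟨𝔮, ⟨?_, ?_⟩, ?_, hmem⟩
  · rw [Ideal.ne_top_iff_one, hmem 1 1 1 W.one_mem (by simp)]
    exact J.ne_top_iff_one.1 hJ.ne_top
  · intro x y hxy
    obtain ⟨s, w, hw, h⟩ := (hL x).1 x.2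
    obtain ⟨t, v, hv, h'⟩ := (hL y).1 y.2
    rw [hmem (x * y) (s * t) (w * v) (W.mul_mem hw hv) (by
      simp only [map_mul, ← h, ← h', Subalgebra.coe_mul]; ring)] at hxy
    rw [hmem x s w hw h, hmem y t v hv h']
    exact hJ.mem_or_mem hxy
  · rintro x ⟨s, w, hs, hw, h⟩
    have hw0 := algebraMap_ne_zero_of_mem_homDenominators hA hw
    let φ := AddMonoidHom.mulRight (algebraMap A (Frac R) w)⁻¹
    have hφ : ∀ y, φ y * algebraMap A (Frac R) w = y := fun y => inv_mul_cancel_right₀ hw0 y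
    have hx : (x : Frac R) = φ (algebraMap A (Frac R) s) :=
      mul_right_cancel₀ hw0 (h.trans (hφ _).symm)
    have hs' := AddSubmonoid.mem_map_of_mem φ (hJh s hs)
    rw [AddMonoidHom.map_mclosure] at hs'
    rw [hx]
    refine AddSubmonoid.closure_mono ?_ hs'
    rintro _ ⟨_, ⟨hy, b, hb, rfl⟩, rfl⟩
    exact ⟨hy.mul hw.1.inv, (hL _).2 ⟨b, w, hw, hφ _⟩, b, w, hb, hw, hφ _⟩

/-- A homogeneous prime of the localization at the homogeneous elements outside `Q` contracts to
a homogeneous prime contained in `Q`. -/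
theorem IsFractionsOf.exists_contraction (hA : Function.Injective (algebraMap A (Frac R)))
    (hAh : IsHomIdealIn 𝒜 (⊤ : Ideal A))
    {Q : Ideal A} [Q.IsPrime] {L : Subalgebra R (Frac R)}
    (hL : IsFractionsOf (homDenominators 𝒜 Q) L)
    {𝔮 : Ideal L} (h𝔮 : 𝔮.IsPrime) (h𝔮h : IsHomIdealOver 𝒜 L 𝔮) :
    ∃ J : Ideal A, J.IsPrime ∧ IsHomIdealIn 𝒜 J ∧ J ≤ Q ∧
      ∀ a, a ∈ J ↔ (⟨algebraMap A (Frac R) a, hL.algebraMap_mem a⟩ : L) ∈ 𝔮 := by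
  let f : A →+* L := (algebraMap A (Frac R)).codRestrict L hL.algebraMap_mem
  have hJh : IsHomIdealIn 𝒜 (𝔮.comap f) :=
    IsHomIdealIn.comap 𝒜 hAh Subtype.val_injective f (fun _ => rfl)
      ((isHomIdealIn_iff_isHomIdealOver 𝒜).2 h𝔮h)
  refine ⟨𝔮.comap f, h𝔮.comap f, hJh, fun a ha => ?_, fun a => Iff.rfl⟩
  have hle : AddSubmonoid.closure
      {y : Frac R | IsHomFrac 𝒜 y ∧ ∃ b ∈ 𝔮.comap f, algebraMap A (Frac R) b = y} ≤
      Q.toAddSubmonoid.map (algebraMap A (Frac R) : A →+ Frac R) := by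
    rw [AddSubmonoid.closure_le]
    rintro _ ⟨hy, b, hb, rfl⟩
    refine ⟨b, by_contra fun hbQ => h𝔮.ne_top ?_, rfl⟩
    have hw : b ∈ homDenominators 𝒜 Q := ⟨hy, hbQ⟩
    have hb0 := algebraMap_ne_zero_of_mem_homDenominators hA hw
    have hinv : (algebraMap A (Frac R) b)⁻¹ ∈ L := (hL _).2 ⟨1, b, hw, by simp [hb0]⟩
    have hone : (⟨_, hinv⟩ : L) * f b = 1 := Subtype.ext (inv_mul_cancel₀ hb0)
    rw [Ideal.eq_top_iff_one, ← hone]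
    exact 𝔮.mul_mem_left _ hb
  obtain ⟨b, hb, hba⟩ := hle (hJh a ha)
  exact hA hba ▸ hb

end Localization

/-- A homogeneous denominator of `R` outside `Q ∩ R` is a homogeneous denominator of `S`
outside `Q`. -/
theorem algebraMap_mem_homDenominators {S : Subalgebra R (Frac R)} {Q : Ideal S} [Q.IsPrime] {w : R}
    (hw : w ∈ homDenominators 𝒜 (Q.comap (algebraMap R S))) :
    algebraMap R S w ∈ homDenominators 𝒜 Q :=
  hw

end HomogeneousFractions

/-- Let `R` be a `G`-graded domain and `S` a graded overring of `R`. Then `S`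
satisfies graded going-down (gGD) over `R` if and only if for each homogeneous prime `Q` of `S`,
the contraction map `h-Spec(S_(Q)) → h-Spec(R_(Q ∩ R))` is surjective. -/
theorem ggd_iff_hSpec_homLoc_surjective
    {G : Type*} [DecidableEq G] [AddCommGroup G] (hG : ∀ g : G, g ≠ 0 → ¬IsOfFinAddOrder g)
    {R : Type*} [CommRing R] [IsDomain R]
    (𝒜 : G → AddSubgroup R) (hGr : IsGrRing 𝒜)
    (S : Subalgebra R (FractionRing R)) (hS : IsGradedOverring 𝒜 S) :
    GGD 𝒜 S ↔
      ∀ Q : Ideal S, Q.IsPrime → IsHomIdealOver 𝒜 S Q →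
        ∀ 𝔭 : Ideal (HomLocR 𝒜 (Q.comap (algebraMap R S))),
          𝔭.IsPrime → IsHomIdealOver 𝒜 (HomLocR 𝒜 (Q.comap (algebraMap R S))) 𝔭 →
          ∃ 𝔮 : Ideal (HomLocOver 𝒜 S Q), 𝔮.IsPrime ∧
            IsHomIdealOver 𝒜 (HomLocOver 𝒜 S Q) 𝔮 ∧
            Contracts (HomLocR 𝒜 (Q.comap (algebraMap R S))) (HomLocOver 𝒜 S Q) 𝔮 𝔭 := by
  let _ := hGr.gradedRing
  have hR : Function.Injective (algebraMap R (FractionRing R)) := IsFractionRing.injective R _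
  have hSi : Function.Injective (algebraMap S (FractionRing R)) := Subtype.val_injective
  constructor
  · intro hgd Q hQ hQh 𝔭 h𝔭 h𝔭h
    have hLR := isFractionsOf_homLocR (𝒜 := 𝒜) (Q.comap (algebraMap R S))
    have hLS := isFractionsOf_homLocOver (𝒜 := 𝒜) S Q
    obtain ⟨P, hP, hPh, hPQ, hP𝔭⟩ := hLR.exists_contraction hR (isHomIdealIn_top 𝒜) h𝔭 h𝔭h
    have hQRh : IsHomIdeal 𝒜 (Q.comap (algebraMap R S)) :=
      (isHomIdealIn_iff_isHomIdeal 𝒜).1 (IsHomIdealIn.comap 𝒜 (isHomIdealIn_top 𝒜) hSi _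
        (fun _ => rfl) ((isHomIdealIn_iff_isHomIdealOver 𝒜).2 hQh))
    obtain ⟨Pt, hPt, hPth, hPtQ, hPtP⟩ := hgd P _ Q hP (hQ.comap _) hQ
      ((isHomIdealIn_iff_isHomIdeal 𝒜).1 hPh) hQRh hQh hPQ rfl
    obtain ⟨𝔮, h𝔮, h𝔮h, h𝔮m⟩ := hLS.exists_extension hSi hPt
      ((isHomIdealIn_iff_isHomIdealOver 𝒜).2 hPth) hPtQ
    refine ⟨𝔮, h𝔮, h𝔮h, fun x => ?_⟩
    have key : ∀ (hx : x ∈ HomLocR 𝒜 (Q.comap (algebraMap R S))) (hx' : x ∈ HomLocOver 𝒜 S Q),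
        (⟨x, hx⟩ : HomLocR 𝒜 (Q.comap (algebraMap R S))) ∈ 𝔭 ↔
          (⟨x, hx'⟩ : HomLocOver 𝒜 S Q) ∈ 𝔮 := by
      intro hx hx'
      obtain ⟨a, w, hw, h⟩ := (hLR x).1 hx
      rw [h𝔮m ⟨x, hx'⟩ (algebraMap R S a) (algebraMap R S w)
        (algebraMap_mem_homDenominators 𝒜 hw) h, ← Ideal.mem_comap, hPtP, hP𝔭]
      have hmul : (⟨x, hx⟩ : HomLocR 𝒜 (Q.comap (algebraMap R S))) *
          ⟨_, hLR.algebraMap_mem w⟩ = ⟨_, hLR.algebraMap_mem a⟩ := Subtype.ext h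
      rw [← hmul]
      exact ⟨fun hx𝔭 => 𝔭.mul_mem_right _ hx𝔭, fun hm => (h𝔭.mem_or_mem hm).resolve_right
        fun hw𝔭 => hw.2 (hPQ ((hP𝔭 w).2 hw𝔭))⟩
    have hmem : x ∈ HomLocR 𝒜 (Q.comap (algebraMap R S)) → x ∈ HomLocOver 𝒜 S Q := by
      intro hx
      obtain ⟨a, w, hw, h⟩ := (hLR x).1 hx
      exact (hLS x).2 ⟨algebraMap R S a, algebraMap R S w,
        algebraMap_mem_homDenominators 𝒜 hw, h⟩
    exact ⟨fun ⟨hx, hx𝔭⟩ => ⟨hx, hmem hx, (key hx _).1 hx𝔭⟩,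
      fun ⟨hx, hx', hx𝔮⟩ => ⟨hx, (key hx hx').2 hx𝔮⟩⟩
  · intro hsurj P Q Qt hP hQ hQt hPh hQh hQth hPQ hQtQ
    subst hQtQ
    have hLR := isFractionsOf_homLocR (𝒜 := 𝒜) (Qt.comap (algebraMap R S))
    have hLS := isFractionsOf_homLocOver (𝒜 := 𝒜) S Qt
    obtain ⟨𝔭, h𝔭, h𝔭h, h𝔭m⟩ := hLR.exists_extension hR hP
      ((isHomIdealIn_iff_isHomIdeal 𝒜).2 hPh) hPQ
    obtain ⟨𝔮, h𝔮, h𝔮h, hc⟩ := hsurj Qt hQt hQth 𝔭 h𝔭 h𝔭h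
    obtain ⟨Pt, hPt, hPth, hPtQ, hPt𝔮⟩ :=
      hLS.exists_contraction hSi (hS.isHomIdealIn_top 𝒜) h𝔮 h𝔮h
    refine ⟨Pt, hPt, (isHomIdealIn_iff_isHomIdealOver 𝒜).1 hPth, hPtQ, ?_⟩
    ext r
    have hr := hLR.algebraMap_mem r
    rw [Ideal.mem_comap, hPt𝔮,
      ← h𝔭m ⟨algebraMap R _ r, hr⟩ r 1 (Submonoid.one_mem _) (by simp)]
    exact ⟨fun h => ((hc _).2 ⟨hr, _, h⟩).2, fun h => ((hc _).1 ⟨hr, h⟩).2.2⟩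
end

section
/- Let G be a torsion-free abelian group, R a G-graded domain, and S a graded R-algebra (i.e., an R-algebra with a G-grading compatible with that of R). Then S is flat as an R-module if and only if for every graded maximal ideal 𝔫 of S, the homogeneous localization S_(𝔫) is flat over the homogeneous localization R_(𝔫∩R). -/
section Stmt1

variable {ι : Type*} [DecidableEq ι] [AddCommMonoid ι]

/-- The multiplicative set of homogeneous elements lying outside the ideal `I`. -/
def homCompl {A : Type*} [CommRing A] (𝒜 : ι → AddSubgroup A) (I : Ideal A) : Submonoid A :=
  Submonoid.closure {a : A | SetLike.IsHomogeneousElem 𝒜 a ∧ a ∉ I}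

/-- The ring homomorphism `R_(𝔫 ∩ R) → S_(𝔫)` between homogeneous localizations induced by a
graded algebra map `R → S` (one sending each graded component of `R` into the corresponding
graded component of `S`). -/
theorem homCompl_le {R S : Type*} [CommRing R] [CommRing S] [Algebra R S]
    (𝒜 : ι → AddSubgroup R) (ℬ : ι → AddSubgroup S)
    (hcomp : ∀ i : ι, ∀ a ∈ 𝒜 i, algebraMap R S a ∈ ℬ i) (𝔫 : Ideal S) :
    homCompl 𝒜 (𝔫.comap (algebraMap R S)) ≤ (homCompl ℬ 𝔫).comap (algebraMap R S) := by
  apply Submonoid.closure_le.mpr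
  intro a ha
  obtain ⟨⟨i, hai⟩, ha2⟩ := ha
  exact Submonoid.subset_closure ⟨⟨i, hcomp i a hai⟩, by simpa using ha2⟩

noncomputable def grLocMap {R S : Type*} [CommRing R] [CommRing S] [Algebra R S]
    (𝒜 : ι → AddSubgroup R) (ℬ : ι → AddSubgroup S)
    (hcomp : ∀ i : ι, ∀ a ∈ 𝒜 i, algebraMap R S a ∈ ℬ i) (𝔫 : Ideal S) :
    Localization (homCompl 𝒜 (𝔫.comap (algebraMap R S))) →+* Localization (homCompl ℬ 𝔫) :=
  IsLocalization.map (Localization (homCompl ℬ 𝔫)) (algebraMap R S)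
    (homCompl_le 𝒜 ℬ hcomp 𝔫)

/-- Flatness of a ring homomorphism: `B` is flat as an `A`-module via `f`. -/
def RingHomFlat {A B : Type*} [CommRing A] [CommRing B] (f : A →+* B) : Prop :=
  @Module.Flat A B _ _ f.toModule

end Stmt1

section HomogeneousIdeals

variable {ι : Type*} [DecidableEq ι] [AddCommMonoid ι] {A : Type*} [CommRing A]
  {𝒜 : ι → AddSubgroup A}

theorem IsGrRing.mem_closure_isHomogeneousElem (h : IsGrRing 𝒜) (x : A) :
    x ∈ AddSubmonoid.closure {y : A | SetLike.IsHomogeneousElem 𝒜 y} := by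
  obtain ⟨f, rfl⟩ := h.internal.2 x
  induction f using DirectSum.induction_on with
  | zero => simp
  | of i a =>
    rw [DirectSum.coeAddMonoidHom_of]
    exact AddSubmonoid.subset_closure ⟨i, a.2⟩
  | add f g hf hg =>
    rw [map_add]
    exact add_mem hf hg

/-- An ideal generated by homogeneous elements is homogeneous. -/
theorem IsGrRing.isHomIdeal_span (h : IsGrRing 𝒜) {s : Set A}
    (hs : ∀ y ∈ s, SetLike.IsHomogeneousElem 𝒜 y) : IsHomIdeal 𝒜 (Ideal.span s) := by
  intro x hx
  refine Submodule.closure_induction (p := fun x _ ↦ x ∈ AddSubmonoid.closure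
    {y : A | SetLike.IsHomogeneousElem 𝒜 y ∧ y ∈ Ideal.span s}) (zero_mem _)
    (fun _ _ _ _ hx hy ↦ add_mem hx hy) ?_ hx
  intro r y hy
  obtain ⟨j, hj⟩ := hs y hy
  have hys : y ∈ Ideal.span s := Ideal.subset_span hy
  rw [smul_eq_mul]
  induction h.mem_closure_isHomogeneousElem r using AddSubmonoid.closure_induction with
  | mem r hr =>
    obtain ⟨i, hi⟩ := hr
    exact AddSubmonoid.subset_closure ⟨⟨i + j, h.mul_mem hi hj⟩, Ideal.mul_mem_left _ _ hys⟩
  | zero => simp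
  | add a b _ _ ha hb =>
    rw [add_mul]
    exact add_mem ha hb

/-- Every proper homogeneous ideal is contained in a graded maximal ideal. -/
theorem IsHomIdeal.exists_le_isGrMaxIdeal {I : Ideal A} (hI : IsHomIdeal 𝒜 I) (hI' : I ≠ ⊤) :
    ∃ 𝔫 : Ideal A, IsGrMaxIdeal 𝒜 𝔫 ∧ I ≤ 𝔫 := by
  obtain ⟨𝔫, hle, ⟨hhom, htop⟩, hmax⟩ :=
    zorn_le_nonempty₀ {J : Ideal A | IsHomIdeal 𝒜 J ∧ J ≠ ⊤} (fun c hc hchain J hJ ↦ by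
      refine ⟨sSup c, ⟨fun x hx ↦ ?_, fun htop ↦ ?_⟩, fun K hK ↦ le_sSup hK⟩
      · obtain ⟨K, hK, hxK⟩ :=
          (Submodule.mem_sSup_of_directed ⟨J, hJ⟩ hchain.directedOn).1 hx
        exact AddSubmonoid.closure_mono (Set.setOf_subset_setOf.2 fun y hy ↦ ⟨hy.1, le_sSup hK hy.2⟩)
          ((hc hK).1 x hxK)
      · have h1 : (1 : A) ∈ sSup c := htop ▸ Submodule.mem_top
        obtain ⟨K, hK, h1K⟩ :=
          (Submodule.mem_sSup_of_directed ⟨J, hJ⟩ hchain.directedOn).1 h1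
        exact (hc hK).2 ((Ideal.eq_top_iff_one K).2 h1K)) I ⟨hI, hI'⟩
  exact ⟨𝔫, ⟨hhom, htop, fun J hJ hle hJtop ↦ le_antisymm (hmax ⟨hJ, hJtop⟩ hle) hle⟩, hle⟩

/-- For every prime `P` there is a graded maximal ideal such that the homogeneous elements
outside of it are also outside `P`. -/
theorem IsGrRing.exists_isGrMaxIdeal_homCompl_le (h : IsGrRing 𝒜) (P : Ideal A) [P.IsPrime] :
    ∃ 𝔫 : Ideal A, IsGrMaxIdeal 𝒜 𝔫 ∧ homCompl 𝒜 𝔫 ≤ P.primeCompl := by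
  have hle : Ideal.span {y : A | SetLike.IsHomogeneousElem 𝒜 y ∧ y ∈ P} ≤ P :=
    Ideal.span_le.2 fun y hy ↦ hy.2
  obtain ⟨𝔫, h𝔫, hcore⟩ := (h.isHomIdeal_span (fun y hy ↦ hy.1)).exists_le_isGrMaxIdeal
    (ne_top_of_le_ne_top (Ideal.IsPrime.ne_top ‹_›) hle)
  exact ⟨𝔫, h𝔫, Submonoid.closure_le.2 fun a ha haP ↦
    ha.2 (hcore (Ideal.subset_span ⟨ha.1, haP⟩))⟩

end HomogeneousIdeals

section Flatness

variable {R S : Type*} [CommRing R] [CommRing S] [Algebra R S]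

/-- The map induced between localizations by a flat algebra is flat. -/
theorem IsLocalization.flat_map_of_flat [Module.Flat R S] (M : Submonoid R) (N : Submonoid S)
    (hle : M ≤ N.comap (algebraMap R S)) :
    (IsLocalization.map (S := Localization M) (Localization N) (algebraMap R S) hle).Flat := by
  algebraize [IsLocalization.map (S := Localization M) (Localization N) (algebraMap R S) hle]
  have : IsScalarTower R (Localization M) (Localization N) := .of_algebraMap_eq fun x ↦ by
    rw [RingHom.algebraMap_toAlgebra, IsLocalization.map_eq, ← IsScalarTower.algebraMap_apply]
  have : Module.Flat S (Localization N) := IsLocalization.flat _ N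
  have : Module.Flat R (Localization N) := .trans R S _
  exact (Module.flat_iff_of_isLocalization (Localization M) M _).2 this

/-- If the map induced between localizations is flat, then any further localization of the
target is flat over the base. -/
theorem IsLocalization.flat_localization_of_flat_map {M : Submonoid R} {N N' : Submonoid S}
    (hle : M ≤ N.comap (algebraMap R S)) (hN : N ≤ N')
    (h : (IsLocalization.map (S := Localization M) (Localization N) (algebraMap R S) hle).Flat) :
    Module.Flat R (Localization N') := by
  algebraize [IsLocalization.map (S := Localization M) (Localization N) (algebraMap R S) hle]
  have : IsScalarTower R (Localization M) (Localization N) := .of_algebraMap_eq fun x ↦ by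
    rw [RingHom.algebraMap_toAlgebra, IsLocalization.map_eq, ← IsScalarTower.algebraMap_apply]
  have : Module.Flat R (Localization M) := IsLocalization.flat _ M
  have : Module.Flat R (Localization N) := .trans R (Localization M) _
  let _ : Algebra (Localization N) (Localization N') :=
    IsLocalization.localizationAlgebraOfSubmonoidLe _ _ N N' hN
  have : IsScalarTower S (Localization N) (Localization N') :=
    IsLocalization.localization_isScalarTower_of_submonoid_le _ _ N N' hN
  have : IsScalarTower R (Localization N) (Localization N') := .to₁₃₄ R S _ _
  have : IsLocalization (N'.map (algebraMap S (Localization N))) (Localization N') :=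
    IsLocalization.isLocalization_of_submonoid_le _ _ N N' hN
  have : Module.Flat (Localization N) (Localization N') :=
    IsLocalization.flat _ (N'.map (algebraMap S (Localization N)))
  exact .trans R (Localization N) _

end Flatness

/-- Let `G` be a torsion-free abelian group, `R` a `G`-graded domain and `S` a
graded `R`-algebra.  Then `S` is flat as an `R`-module if and only if for every graded maximal
ideal `𝔫` of `S` the homogeneous localization `S_(𝔫)` is flat over `R_(𝔫 ∩ R)`. -/
theorem flat_iff_forall_grMax_homLoc_flat
    {G : Type*} [DecidableEq G] [AddCommGroup G] (hG : IsAddTorsionFree G)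
    {R : Type*} [CommRing R] [IsDomain R] {S : Type*} [CommRing S] [Algebra R S]
    (𝒜 : G → AddSubgroup R) (ℬ : G → AddSubgroup S)
    (hGrR : IsGrRing 𝒜) (hGrS : IsGrRing ℬ)
    (hcomp : ∀ i : G, ∀ a ∈ 𝒜 i, algebraMap R S a ∈ ℬ i) :
    Module.Flat R S ↔
      ∀ 𝔫 : Ideal S, IsGrMaxIdeal ℬ 𝔫 → RingHomFlat (grLocMap 𝒜 ℬ hcomp 𝔫) := by
  refine ⟨fun _ 𝔫 _ ↦ IsLocalization.flat_map_of_flat _ _ (homCompl_le 𝒜 ℬ hcomp 𝔫), fun h ↦ ?_⟩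
  refine Module.flat_of_isLocalized_maximal S S (fun P ↦ Localization.AtPrime P)
    (fun P ↦ Algebra.linearMap S _) fun P _ ↦ ?_
  obtain ⟨𝔫, h𝔫, hle⟩ := hGrS.exists_isGrMaxIdeal_homCompl_le P
  exact IsLocalization.flat_localization_of_flat_map (homCompl_le 𝒜 ℬ hcomp 𝔫) hle (h 𝔫 h𝔫)
end

section
/- Let R be a G-graded domain. If R is a graded globally perinormal domain, then R_W is a graded globally perinormal domain for every multiplicative subset W of R consisting of homogeneous elements. -/
section LocalizationAtHomogeneousSet

variable {R : Type*} [CommRing R]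

theorem IsLocalizationOfR.isLocalizationOfSub {S : Subalgebra R (FractionRing R)}
    (h : IsLocalizationOfR S) (T : Subalgebra R (FractionRing R)) :
    IsLocalizationOfSub T S := by
  obtain ⟨V, hV, hS⟩ := h
  refine ⟨V.map (algebraMap R (FractionRing R)), ?_, ?_, ?_⟩
  · rintro _ ⟨w, _, rfl⟩
    exact T.algebraMap_mem w
  · rintro _ ⟨w, hw, rfl⟩
    obtain ⟨y, hy⟩ := (hV w hw).exists_right_inv
    exact ⟨y, y.2, congrArg Subtype.val hy⟩
  · intro s hs
    obtain ⟨r, w, hw, h⟩ := hS ⟨s, hs⟩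
    exact ⟨_, T.algebraMap_mem r, _, ⟨w, hw, rfl⟩, congrArg Subtype.val h⟩

theorem mem_locW_iff (W : Submonoid R) (x : FractionRing R) :
    x ∈ LocW W ↔ ∃ r : R, ∃ w ∈ W,
      x * algebraMap R (FractionRing R) w = algebraMap R (FractionRing R) r := by
  refine ⟨fun hx => ?_, fun hx => Algebra.subset_adjoin hx⟩
  induction hx using Algebra.adjoin_induction with
  | mem x hx => exact hx
  | algebraMap r => exact ⟨r, 1, W.one_mem, by simp⟩
  | add x y _ _ hx hy =>
    obtain ⟨r, w, hw, h⟩ := hx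
    obtain ⟨r', w', hw', h'⟩ := hy
    refine ⟨r * w' + r' * w, w * w', W.mul_mem hw hw', ?_⟩
    simp only [map_mul, map_add, ← h, ← h']
    ring
  | mul x y _ _ hx hy =>
    obtain ⟨r, w, hw, h⟩ := hx
    obtain ⟨r', w', hw', h'⟩ := hy
    refine ⟨r * r', w * w', W.mul_mem hw hw', ?_⟩
    simp only [map_mul, ← h, ← h']
    ring

/-- The extension to `R_W` of an ideal `P` of `R`, consisting of the fractions `p / w` with
`p ∈ P` and `w ∈ W`. -/
def extendLocW (W : Submonoid R) (P : Ideal R) : Ideal (LocW W) where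
  carrier := {x | ∃ p ∈ P, ∃ w ∈ W,
    (x : FractionRing R) * algebraMap R (FractionRing R) w = algebraMap R (FractionRing R) p}
  zero_mem' := ⟨0, P.zero_mem, 1, W.one_mem, by simp⟩
  add_mem' := by
    rintro x y ⟨p, hp, w, hw, h⟩ ⟨p', hp', w', hw', h'⟩
    refine ⟨p * w' + p' * w, P.add_mem (P.mul_mem_right _ hp) (P.mul_mem_right _ hp'),
      w * w', W.mul_mem hw hw', ?_⟩
    simp only [map_mul, map_add, ← h, ← h', Subalgebra.coe_add]
    ring
  smul_mem' := by
    rintro c x ⟨p, hp, w, hw, h⟩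
    obtain ⟨r, v, hv, h'⟩ := (mem_locW_iff W c).1 c.2
    refine ⟨r * p, P.mul_mem_left _ hp, v * w, W.mul_mem hv hw, ?_⟩
    simp only [map_mul, ← h, ← h', smul_eq_mul, Subalgebra.coe_mul]
    ring

theorem mem_of_mem_extendLocW {W : Submonoid R} {P : Ideal R} [hP : P.IsPrime]
    (hWP : ∀ w ∈ W, w ∉ P) {x : LocW W} (hx : x ∈ extendLocW W P) {r v : R}
    (h : (x : FractionRing R) * algebraMap R (FractionRing R) v =
      algebraMap R (FractionRing R) r) : r ∈ P := by
  obtain ⟨p, hp, w, hw, h'⟩ := hx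
  have key : r * w = p * v := by
    apply IsFractionRing.injective R (FractionRing R)
    simp only [map_mul, ← h, ← h']
    ring
  exact (hP.mem_or_mem (key ▸ P.mul_mem_right v hp : r * w ∈ P)).resolve_right (hWP w hw)

theorem isPrime_extendLocW {W : Submonoid R} {P : Ideal R} [hP : P.IsPrime]
    (hWP : ∀ w ∈ W, w ∉ P) : (extendLocW W P).IsPrime := by
  refine ⟨fun htop => ?_, fun {x y} hxy => ?_⟩
  · have h1 : (1 : LocW W) ∈ extendLocW W P := htop ▸ Submodule.mem_top
    exact hWP 1 W.one_mem (mem_of_mem_extendLocW hWP h1 (v := 1) (by simp))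
  · obtain ⟨r, w, hw, h⟩ := (mem_locW_iff W x).1 x.2
    obtain ⟨r', w', hw', h'⟩ := (mem_locW_iff W y).1 y.2
    have hrr : r * r' ∈ P := by
      refine mem_of_mem_extendLocW hWP hxy (v := w * w') ?_
      simp only [map_mul, ← h, ← h', Subalgebra.coe_mul]
      ring
    rcases hP.mem_or_mem hrr with hr | hr
    · exact Or.inl ⟨r, hr, w, hw, h⟩
    · exact Or.inr ⟨r', hr, w', hw', h'⟩

theorem extendLocW_mono {W : Submonoid R} {P Q : Ideal R} (h : P ≤ Q) :
    extendLocW W P ≤ extendLocW W Q :=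
  fun _ ⟨p, hp, hx⟩ => ⟨p, h hp, hx⟩

variable [IsDomain R]

theorem isHomIdealOver_extendLocW {G : Type*} [DecidableEq G] [AddCommMonoid G]
    {𝒜 : G → AddSubgroup R} {W : Submonoid R}
    (hW : ∀ w ∈ W, w ≠ 0 ∧ SetLike.IsHomogeneousElem 𝒜 w) {P : Ideal R}
    (hP : IsHomIdeal 𝒜 P) : IsHomIdealOver 𝒜 (LocW W) (extendLocW W P) := by
  rintro x ⟨p, hp, w, hw, h⟩
  obtain ⟨hw0, j, hwj⟩ := hW w hw
  have hw0' : algebraMap R (FractionRing R) w ≠ 0 := by simpa using hw0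
  rw [eq_div_of_mul_eq hw0' h]
  clear h x
  have hp' := hP p hp
  clear hp
  induction hp' using AddSubmonoid.closure_induction with
  | mem a ha =>
    obtain ⟨⟨i, hai⟩, haP⟩ := ha
    have hdiv := div_mul_cancel₀ (algebraMap R (FractionRing R) a) hw0'
    exact AddSubmonoid.subset_closure ⟨⟨i, j, a, w, hai, hwj, hw0, hdiv⟩,
      (mem_locW_iff W _).2 ⟨a, w, hw, hdiv⟩, a, haP, w, hw, hdiv⟩
  | zero => simp
  | add a b _ _ ha hb =>
    rw [map_add, add_div]
    exact add_mem ha hb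

theorem contracts_extendLocW {W : Submonoid R} (hW : ∀ w ∈ W, w ≠ 0)
    {S : Subalgebra R (FractionRing R)} (hS : LocW W ≤ S) (J : Ideal S) :
    Contracts (LocW W) S J (extendLocW W (J.comap (algebraMap R S))) := by
  intro x
  constructor
  · rintro ⟨hx, p, hp, w, hw, h⟩
    have hw0 : algebraMap R (FractionRing R) w ≠ 0 := by simpa using hW w hw
    have hinv : (algebraMap R (FractionRing R) w)⁻¹ ∈ S :=
      hS ((mem_locW_iff W _).2 ⟨1, w, hw, by simp [hw0]⟩)
    refine ⟨hx, hS hx, ?_⟩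
    have hmem := J.mul_mem_right ⟨_, hinv⟩ (Ideal.mem_comap.1 hp)
    convert hmem using 1
    exact Subtype.ext (eq_div_of_mul_eq hw0 h)
  · rintro ⟨hx, hxS, hxJ⟩
    obtain ⟨r, w, hw, h⟩ := (mem_locW_iff W x).1 hx
    refine ⟨hx, r, ?_, w, hw, h⟩
    have hmem := J.mul_mem_right (algebraMap R S w) hxJ
    rw [Ideal.mem_comap]
    convert hmem using 1
    exact Subtype.ext h.symm

theorem GGDSub.ggd_of_locW {G : Type*} [DecidableEq G] [AddCommMonoid G]
    {𝒜 : G → AddSubgroup R} {W : Submonoid R}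
    (hW : ∀ w ∈ W, w ≠ 0 ∧ SetLike.IsHomogeneousElem 𝒜 w)
    {S : Subalgebra R (FractionRing R)} (hS : LocW W ≤ S) (h : GGDSub 𝒜 (LocW W) S) :
    GGD 𝒜 S := by
  rintro P Q Qt hP hQ hQt hPh hQh hQth hPQ rfl
  have hWQ : ∀ w ∈ W, w ∉ Qt.comap (algebraMap R S) := by
    intro w hw hwQ
    have hw0 : algebraMap R (FractionRing R) w ≠ 0 := by simpa using (hW w hw).1
    have hinv : (algebraMap R (FractionRing R) w)⁻¹ ∈ S :=
      hS ((mem_locW_iff W _).2 ⟨1, w, hw, by simp [hw0]⟩)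
    refine hQt.ne_top ((Ideal.eq_top_iff_one _).2 ?_)
    have hmem := Qt.mul_mem_right ⟨_, hinv⟩ (Ideal.mem_comap.1 hwQ)
    convert hmem using 1
    exact Subtype.ext (mul_inv_cancel₀ hw0).symm
  have hWP : ∀ w ∈ W, w ∉ P := fun w hw hwP => hWQ w hw (hPQ hwP)
  obtain ⟨Pt, hPt, hPth, hPtQt, hc⟩ := h (extendLocW W P) (extendLocW W _) Qt
    (isPrime_extendLocW hWP) (isPrime_extendLocW hWQ) hQt
    (isHomIdealOver_extendLocW hW hPh) (isHomIdealOver_extendLocW hW hQh) hQth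
    (extendLocW_mono hPQ) (contracts_extendLocW (fun w hw => (hW w hw).1) hS Qt)
  refine ⟨Pt, hPt, hPth, hPtQt, Ideal.ext fun r => ?_⟩
  rw [Ideal.mem_comap]
  constructor
  · intro hr
    obtain ⟨_, hx⟩ := (hc (algebraMap R (FractionRing R) r)).2
      ⟨(LocW W).algebraMap_mem r, S.algebraMap_mem r, hr⟩
    exact mem_of_mem_extendLocW hWP hx (v := 1) (by simp)
  · intro hr
    obtain ⟨_, _, hx⟩ := (hc (algebraMap R (FractionRing R) r)).1
      ⟨(LocW W).algebraMap_mem r, r, hr, 1, W.one_mem, by simp⟩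
    exact hx

end LocalizationAtHomogeneousSet

/-- Let `R` be a `G`-graded domain. If `R` is a graded globally perinormal
domain, then `R_W` is a graded globally perinormal domain for every multiplicative subset `W`
of `R` consisting of (nonzero) homogeneous elements. -/
theorem gradedGloballyPerinormal_localization
    {G : Type*} [DecidableEq G] [AddCommGroup G] (hG : ∀ g : G, g ≠ 0 → ¬IsOfFinAddOrder g)
    {R : Type*} [CommRing R] [IsDomain R]
    (𝒜 : G → AddSubgroup R) (hGr : IsGrRing 𝒜)
    (hR : GradedGloballyPerinormal 𝒜)
    (W : Submonoid R) (hW : ∀ w ∈ W, w ≠ 0 ∧ SetLike.IsHomogeneousElem 𝒜 w) :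
    GradedGloballyPerinormalSub 𝒜 (LocW W) := by
  intro S hS hSgr hgd
  exact (hR S hSgr (hgd.ggd_of_locW hW hS)).isLocalizationOfSub (LocW W)
end
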